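/- Fix real parameters a > 0 and b ∈ (0,1). Consider the planar vector field G(x, r₁) = ( r₁(a − r₁), r₁(x + 2b·r₁) ), which is the restriction of the blown-up Le Corbeiller system in chart K₁ to the invariant plane ε₁ = 0. Then the point p₁ = (−2ba, a) is an equilibrium of G, and the derivative of G at p₁ has complex-conjugate eigenvalues a·b ± i·a·√(1−b²); in particular both eigenvalues have positive real part a·b > 0 and nonzero imaginary part, so p₁ is an unstable focus. -/

import Mathlib

/-- The blown-up Le Corbeiller system in chart `K₁` restricted to the invariant plane
`ε₁ = 0`, coordinates `(x, r₁)`. -/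
noncomputable def corbK1eps0Field (a b : ℝ) (p : ℝ × ℝ) : ℝ × ℝ :=
  (p.2 * (a - p.2), p.2 * (p.1 + 2 * b * p.2))

/-- The images of the standard basis vectors under an endomorphism of `R × R` determine its
characteristic polynomial. -/
theorem LinearMap.charpoly_prod_self {R : Type*} [CommRing R] [Nontrivial R]
    (f : R × R →ₗ[R] R × R) :
    f.charpoly = Polynomial.X ^ 2 - Polynomial.C ((f (1, 0)).1 + (f (0, 1)).2) * Polynomial.X +
      Polynomial.C ((f (1, 0)).1 * (f (0, 1)).2 - (f (0, 1)).1 * (f (1, 0)).2) := by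
  rw [← f.charpoly_toMatrix (Module.Basis.finTwoProd R), Matrix.charpoly_fin_two,
    Matrix.trace_fin_two, Matrix.det_fin_two]
  simp [LinearMap.toMatrix_apply]

theorem hasFDerivAt_corbK1eps0Field (a b : ℝ) (p : ℝ × ℝ) :
    HasFDerivAt (corbK1eps0Field a b)
      (((a - 2 * p.2) • ContinuousLinearMap.snd ℝ ℝ ℝ).prod
        (p.2 • ContinuousLinearMap.fst ℝ ℝ ℝ +
          (p.1 + 4 * b * p.2) • ContinuousLinearMap.snd ℝ ℝ ℝ)) p := by
  have hx : HasFDerivAt Prod.fst (ContinuousLinearMap.fst ℝ ℝ ℝ) p := hasFDerivAt_fst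
  have hr : HasFDerivAt Prod.snd (ContinuousLinearMap.snd ℝ ℝ ℝ) p := hasFDerivAt_snd
  refine ((hr.mul (hr.const_sub a)).prodMk
    (hr.mul (hx.add (hr.const_mul (2 * b))))).congr_fderiv ?_
  ext <;> simp <;> ring

theorem charpoly_fderiv_corbK1eps0Field (a b : ℝ) :
    LinearMap.charpoly ((fderiv ℝ (corbK1eps0Field a b) (-2 * b * a, a)).toLinearMap) =
      Polynomial.X ^ 2 - Polynomial.C (2 * a * b) * Polynomial.X + Polynomial.C (a ^ 2) := by
  rw [(hasFDerivAt_corbK1eps0Field a b _).fderiv, LinearMap.charpoly_prod_self]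
  congr 3
  · congr 1
    simp
    ring
  · simp
    ring

/-- The point `p₁ = (−2ba, a)` is an equilibrium, and the linearization there has
characteristic polynomial `λ² − 2ab·λ + a²`, whose complex roots are
`ab ± i·a·√(1−b²)`: a pair of complex-conjugate eigenvalues with positive real part
`ab > 0` and nonzero imaginary part, so `p₁` is an unstable focus. -/
theorem corbK1_unstable_focus (a b : ℝ) (ha : 0 < a) (hb : b ∈ Set.Ioo (0 : ℝ) 1) :
    corbK1eps0Field a b (-2 * b * a, a) = 0 ∧
    LinearMap.charpoly ((fderiv ℝ (corbK1eps0Field a b) (-2 * b * a, a)).toLinearMap) =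
      Polynomial.X ^ 2 - Polynomial.C (2 * a * b) * Polynomial.X + Polynomial.C (a ^ 2) ∧
    Polynomial.aeval (((a * b : ℝ) : ℂ) + ((a * Real.sqrt (1 - b ^ 2) : ℝ) : ℂ) * Complex.I)
      (LinearMap.charpoly ((fderiv ℝ (corbK1eps0Field a b) (-2 * b * a, a)).toLinearMap))
      = 0 ∧
    Polynomial.aeval (((a * b : ℝ) : ℂ) - ((a * Real.sqrt (1 - b ^ 2) : ℝ) : ℂ) * Complex.I)
      (LinearMap.charpoly ((fderiv ℝ (corbK1eps0Field a b) (-2 * b * a, a)).toLinearMap))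
      = 0 ∧
    0 < a * b ∧ a * Real.sqrt (1 - b ^ 2) ≠ 0 := by
  have hs : 0 < 1 - b ^ 2 := by nlinarith [hb.1, hb.2]
  have hsq : ((Real.sqrt (1 - b ^ 2) : ℝ) : ℂ) ^ 2 = 1 - (b : ℂ) ^ 2 := by
    exact_mod_cast Real.sq_sqrt hs.le
  refine ⟨?_, charpoly_fderiv_corbK1eps0Field a b, ?_, ?_, mul_pos ha hb.1,
    (mul_pos ha (Real.sqrt_pos.2 hs)).ne'⟩
  · ext <;> simp [corbK1eps0Field]
  all_goals
    rw [charpoly_fderiv_corbK1eps0Field]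
    simp only [map_add, map_sub, map_mul, map_pow, Polynomial.aeval_X, Polynomial.aeval_C,
      Complex.coe_algebraMap, Complex.ofReal_mul, Complex.ofReal_ofNat]
    linear_combination (a : ℂ) ^ 2 * (Real.sqrt (1 - b ^ 2) : ℂ) ^ 2 * Complex.I_sq -
      (a : ℂ) ^ 2 * hsq
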